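/- Let P > 0 and let K be an odd 2P-periodic function, locally integrable on ℝ∖2Pℤ, with |K(x)| ≤ C/|x| for x ∈ [−P,P]∖{0}. Let w be a 2P-periodic function with ∫_{−P}^{P} w(x) dx = 0 and Tot.Var.{w;[−P,P]} = β_w < ∞. Then the principal value G_per[w](x) exists for a.e. x and ‖G_per[w]‖_{L¹([−P,P])} ≤ C·‖w‖_{L¹([−P,P])}·( 2 + 3 ln 2 + 2 ln P + 2 ln β_w − 2 ln ‖w‖_{L¹([−P,P])} ). -/

import Mathlib

open MeasureTheory Filter Topology
open scoped ENNReal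

noncomputable section

/-- The principal value of the periodic singular convolution
`∫_{(-P,P)} K(y) g(x-y) dy` at the point `x` equals `L`. -/
def PVPerAt (K g : ℝ → ℝ) (P x L : ℝ) : Prop :=
  Tendsto (fun ε : ℝ => ∫ y in Set.Ioo (-P) P \ Set.Ioo (-ε) ε, K y * g (x - y))
    (𝓝[>] 0) (𝓝 L)

lemma eVariationOn_Icc_add_const {w : ℝ → ℝ} {c : ℝ} (hw : Function.Periodic w c) (a b : ℝ) :
    eVariationOn w (Set.Icc (a + c) (b + c)) = eVariationOn w (Set.Icc a b) := by
  rw [← Set.image_add_const_Icc, ← eVariationOn.comp_eq_of_monotoneOn w (fun x => x + c)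
    (fun x _ y _ h => by simpa using h)]
  congr 1
  ext x
  exact hw x

lemma eVariationOn_Icc_add_Icc (w : ℝ → ℝ) {a b c : ℝ} (hab : a ≤ b) (hbc : b ≤ c) :
    eVariationOn w (Set.Icc a b) + eVariationOn w (Set.Icc b c) = eVariationOn w (Set.Icc a c) := by
  simpa using eVariationOn.Icc_add_Icc w hab hbc (Set.mem_univ b)

lemma eVariationOn_Icc_period {w : ℝ → ℝ} {T : ℝ} (hT : 0 < T) (hw : Function.Periodic w T)
    (a x : ℝ) :
    eVariationOn w (Set.Icc x (x + T)) = eVariationOn w (Set.Icc a (a + T)) := by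
  obtain ⟨n, ⟨h₁, h₂⟩, -⟩ := existsUnique_add_zsmul_mem_Ico hT x a
  rw [← eVariationOn_Icc_add_const (hw.zsmul n) x, add_right_comm]
  set y := x + n • T
  rw [← eVariationOn_Icc_add_Icc w h₂.le (by linarith), eVariationOn_Icc_add_const hw,
    add_comm, eVariationOn_Icc_add_Icc w h₁ h₂.le]

lemma locallyBoundedVariationOn_of_periodic {w : ℝ → ℝ} {T : ℝ} (hT : 0 < T)
    (hw : Function.Periodic w T) {a : ℝ} (h : eVariationOn w (Set.Icc a (a + T)) ≠ ⊤) :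
    LocallyBoundedVariationOn w Set.univ := by
  intro x y _ _
  rw [Set.univ_inter]
  have key : ∀ n : ℕ, eVariationOn w (Set.Icc x (x + n * T)) ≠ ⊤ := by
    intro n
    induction n with
    | zero => simp [eVariationOn.subsingleton]
    | succ n ih =>
      have h0 : (0 : ℝ) ≤ n * T := by positivity
      rw [← eVariationOn_Icc_add_Icc w (b := x + n * T) (by linarith) (by push_cast; linarith)]
      refine ENNReal.add_ne_top.2 ⟨ih, ?_⟩
      have := eVariationOn_Icc_period hT hw a (x + n * T)
      rw [show x + ((n + 1 : ℕ) : ℝ) * T = x + n * T + T by push_cast; ring, this]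
      exact h
  obtain ⟨n, hn⟩ := exists_nat_ge ((y - x) / T)
  rw [div_le_iff₀ hT] at hn
  exact ne_top_of_le_ne_top (key n)
    (eVariationOn.mono w (Set.Icc_subset_Icc le_rfl (by linarith)))

/-- A periodic function of bounded variation is dominated by a monotone function which grows by
the total variation over each period. -/
lemma exists_monotone_of_periodic {w : ℝ → ℝ} {T : ℝ} (hT : 0 < T)
    (hw : Function.Periodic w T) {a β : ℝ} (hβ : 0 ≤ β)
    (h : eVariationOn w (Set.Icc a (a + T)) = ENNReal.ofReal β) :
    ∃ V : ℝ → ℝ, Monotone V ∧ (∀ x, V (x + T) = V x + β) ∧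
      ∀ x y, x ≤ y → |w y - w x| ≤ V y - V x := by
  have hV := locallyBoundedVariationOn_of_periodic hT hw (a := a) (by simp [h])
  have hsub : ∀ x y, x ≤ y → variationOnFromTo w Set.univ 0 y - variationOnFromTo w Set.univ 0 x
      = (eVariationOn w (Set.Icc x y)).toReal := by
    intro x y hxy
    rw [variationOnFromTo.sub_right hV trivial trivial trivial,
      variationOnFromTo.eq_of_le _ _ hxy, Set.univ_inter]
  refine ⟨variationOnFromTo w Set.univ 0, ?_, ?_, ?_⟩
  · exact monotoneOn_univ.1 (variationOnFromTo.monotoneOn hV trivial)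
  · intro x
    have := hsub x (x + T) (by linarith)
    rw [eVariationOn_Icc_period hT hw a, h, ENNReal.toReal_ofReal hβ] at this
    linarith
  · intro x y hxy
    rw [hsub x y hxy, ← Real.dist_eq, dist_edist]
    refine ENNReal.toReal_mono ?_ (eVariationOn.edist_le w ⟨hxy, le_rfl⟩ ⟨le_rfl, hxy⟩)
    exact Set.univ_inter (Set.Icc x y) ▸ hV x y trivial trivial

/-- The `L¹` modulus of continuity of a periodic function of bounded variation. -/
lemma integral_abs_sub_le_variation {w V : ℝ → ℝ} {P β y : ℝ} (hP : 0 < P) (hV : Monotone V)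
    (hVper : ∀ x, V (x + 2 * P) = V x + β) (hwV : ∀ x y, x ≤ y → |w y - w x| ≤ V y - V x)
    (hwm : Measurable w) (hy : 0 ≤ y) :
    ∫ x in (-P)..P, |w (x - y) - w (x + y)| ≤ 2 * y * β := by
  have hi : ∀ a b, IntervalIntegrable V volume a b := fun a b => hV.intervalIntegrable
  have hVp : ∀ a b, IntervalIntegrable (fun x => V (x + y)) volume a b := fun a b =>
    (hV.comp (fun _ _ h => by simpa using h : Monotone fun x => x + y)).intervalIntegrable
  have hVm : ∀ a b, IntervalIntegrable (fun x => V (x - y)) volume a b := fun a b =>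
    (hV.comp (fun _ _ h => by simpa using h : Monotone fun x => x - y)).intervalIntegrable
  have hb : ∀ x, |w (x - y) - w (x + y)| ≤ V (x + y) - V (x - y) := fun x => by
    rw [abs_sub_comm]; exact hwV _ _ (by linarith)
  have hshift : ∫ x in (-P - y)..(-P + y), V (x + 2 * P) = ∫ x in (P - y)..(P + y), V x := by
    rw [intervalIntegral.integral_comp_add_right]
    congr 1 <;> ring
  calc ∫ x in (-P)..P, |w (x - y) - w (x + y)|
      ≤ ∫ x in (-P)..P, (V (x + y) - V (x - y)) := by
        refine intervalIntegral.integral_mono (by linarith) ?_ ((hVp _ _).sub (hVm _ _)) hb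
        refine ((hVp _ _).sub (hVm _ _)).mono_fun (by fun_prop) ?_
        refine Eventually.of_forall fun x => ?_
        simp only [Real.norm_eq_abs, abs_abs]
        exact (hb x).trans (le_abs_self _)
    _ = (∫ x in (-P + y)..(P + y), V x) - ∫ x in (-P - y)..(P - y), V x := by
        rw [intervalIntegral.integral_sub (hVp _ _) (hVm _ _),
          intervalIntegral.integral_comp_add_right, intervalIntegral.integral_comp_sub_right]
    _ = (∫ x in (P - y)..(P + y), V x) - ∫ x in (-P - y)..(-P + y), V x := by
        have h1 := intervalIntegral.integral_add_adjacent_intervals (hi (-P - y) (-P + y))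
          (hi (-P + y) (P + y))
        have h2 := intervalIntegral.integral_add_adjacent_intervals (hi (-P - y) (P - y))
          (hi (P - y) (P + y))
        linarith
    _ = 2 * y * β := by
        rw [← hshift]
        simp_rw [hVper]
        rw [intervalIntegral.integral_add (hi _ _) intervalIntegrable_const,
          intervalIntegral.integral_const, smul_eq_mul]
        ring

/-- A periodic function whose integral over a period vanishes is bounded by its variation. -/
lemma abs_le_of_periodic_of_integral_eq_zero {w V : ℝ → ℝ} {P β : ℝ} (hP : 0 < P)
    (hV : Monotone V) (hVper : ∀ x, V (x + 2 * P) = V x + β)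
    (hwV : ∀ x y, x ≤ y → |w y - w x| ≤ V y - V x)
    (hwm : Measurable w) (hwper : Function.Periodic w (2 * P))
    (hw0 : ∫ x in (-P)..P, w x = 0) (x : ℝ) : |w x| ≤ β := by
  have hd : ∀ z ∈ Set.uIoc x (x + 2 * P), ‖w x - w z‖ ≤ β := by
    intro z hz
    rw [Set.uIoc_of_le (by linarith)] at hz
    have h1 := hwV x z hz.1.le
    have h2 := hV hz.2
    rw [hVper] at h2
    rw [Real.norm_eq_abs, abs_sub_comm]
    linarith
  have hi : IntervalIntegrable (fun z => w x - w z) volume x (x + 2 * P) := by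
    refine (intervalIntegrable_const (c := β)).mono_fun (by fun_prop) ?_
    filter_upwards [ae_restrict_mem measurableSet_uIoc] with z hz
    exact (hd z hz).trans (le_abs_self _)
  have hiw : IntervalIntegrable w volume x (x + 2 * P) := by
    simpa using (intervalIntegrable_const (c := w x)).sub hi
  have h0 : ∫ z in x..(x + 2 * P), w z = 0 := by
    rw [hwper.intervalIntegral_add_eq x (-P), show -P + 2 * P = P by ring, hw0]
  have h1 : ∫ z in x..(x + 2 * P), (w x - w z) = 2 * P * w x := by
    rw [intervalIntegral.integral_sub intervalIntegrable_const hiw, h0]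
    simp
  have h2 := intervalIntegral.norm_integral_le_of_norm_le_const hd
  rw [h1, Real.norm_eq_abs, abs_mul, abs_of_pos (by positivity : 0 < 2 * P), add_sub_cancel_left,
    abs_of_pos (by positivity : 0 < 2 * P), mul_comm] at h2
  exact le_of_mul_le_mul_right h2 (by positivity)

lemma integral_abs_sub_le_two_mul {w : ℝ → ℝ} {P β : ℝ} (hP : 0 < P)
    (hwm : Measurable w) (hwper : Function.Periodic w (2 * P)) (hwb : ∀ x, |w x| ≤ β) (y : ℝ) :
    ∫ x in (-P)..P, |w (x - y) - w (x + y)| ≤ 2 * ∫ x in (-P)..P, |w x| := by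
  have hi : ∀ f : ℝ → ℝ, Measurable f →
      IntervalIntegrable (fun x => |w (f x)|) volume (-P) P := by
    intro f hf
    refine (intervalIntegrable_const (c := β)).mono_fun
      (hwm.comp hf).norm.aestronglyMeasurable ?_
    refine Eventually.of_forall fun z => ?_
    simp only [Real.norm_eq_abs, abs_abs]
    exact (hwb _).trans (le_abs_self _)
  have hper : Function.Periodic (fun x => |w x|) (2 * P) := fun x => by simp [hwper x]
  have htr : ∀ c, ∫ x in (-P + c)..(P + c), |w x| = ∫ x in (-P)..P, |w x| := by
    intro c
    have := hper.intervalIntegral_add_eq (-P + c) (-P)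
    rw [show -P + c + 2 * P = P + c by ring, show -P + 2 * P = P by ring] at this
    exact this
  have h1 := hi (fun x => x - y) (by fun_prop)
  have h2 := hi (fun x => x + y) (by fun_prop)
  calc ∫ x in (-P)..P, |w (x - y) - w (x + y)|
      ≤ ∫ x in (-P)..P, (|w (x - y)| + |w (x + y)|) := by
        refine intervalIntegral.integral_mono (by linarith) ?_ (h1.add h2) fun x => abs_sub _ _
        refine (h1.add h2).mono_fun (by fun_prop) (Eventually.of_forall fun x => ?_)
        simp only [Real.norm_eq_abs, abs_abs]
        exact (abs_sub _ _).trans (le_abs_self _)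
    _ = 2 * ∫ x in (-P)..P, |w x| := by
        rw [intervalIntegral.integral_add h1 h2,
          intervalIntegral.integral_comp_sub_right (fun x => |w x|),
          intervalIntegral.integral_comp_add_right (fun x => |w x|),
          sub_eq_add_neg, sub_eq_add_neg, htr, htr, two_mul]

/-- The integral of `min`-type bounds `2 C β` near the origin and `2 C N / y` away from it. -/
lemma integrableOn_and_integral_ite {P δ a b : ℝ} (hδ : 0 < δ) (hδP : δ ≤ P) :
    IntegrableOn (fun y => if y ≤ δ then a else b * y⁻¹) (Set.Ioc 0 P) ∧
      ∫ y in Set.Ioc 0 P, (if y ≤ δ then a else b * y⁻¹) = a * δ + b * Real.log (P / δ) := by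
  have hP : 0 < P := hδ.trans_le hδP
  have e1 : Set.EqOn (fun y : ℝ => if y ≤ δ then a else b * y⁻¹) (fun _ => a) (Set.Ioc 0 δ) :=
    fun y hy => if_pos hy.2
  have e2 : Set.EqOn (fun y : ℝ => if y ≤ δ then a else b * y⁻¹) (fun y => b * y⁻¹)
      (Set.Ioc δ P) := fun y hy => if_neg (not_le.2 hy.1)
  have h0 : (0 : ℝ) ∉ Set.uIcc δ P := by
    rw [Set.uIcc_of_le hδP]; exact fun h => absurd h.1 (not_le.2 hδ)
  have i2' : IntervalIntegrable (fun y : ℝ => b * y⁻¹) volume δ P := by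
    refine IntervalIntegrable.const_mul ?_ b
    exact intervalIntegral.intervalIntegrable_inv (fun x hx => ne_of_mem_of_not_mem hx h0)
      continuousOn_id
  have i1 : IntegrableOn (fun y : ℝ => if y ≤ δ then a else b * y⁻¹) (Set.Ioc 0 δ) :=
    (integrableOn_congr_fun e1 measurableSet_Ioc).2 (integrableOn_const (by simp))
  have i2 : IntegrableOn (fun y : ℝ => if y ≤ δ then a else b * y⁻¹) (Set.Ioc δ P) :=
    (integrableOn_congr_fun e2 measurableSet_Ioc).2
      ((intervalIntegrable_iff_integrableOn_Ioc_of_le hδP).1 i2')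
  rw [← Set.Ioc_union_Ioc_eq_Ioc hδ.le hδP]
  refine ⟨i1.union i2, ?_⟩
  rw [setIntegral_union (Set.Ioc_disjoint_Ioc_of_le le_rfl) measurableSet_Ioc i1 i2,
    setIntegral_congr_fun measurableSet_Ioc e1, setIntegral_congr_fun measurableSet_Ioc e2,
    ← intervalIntegral.integral_of_le hδ.le, ← intervalIntegral.integral_of_le hδP,
    intervalIntegral.integral_const, intervalIntegral.integral_const_mul,
    integral_inv_of_pos hδ hP, smul_eq_mul, sub_zero, mul_comm δ]

lemma integrable_prod_symmetrized_kernel {P C β δ : ℝ} {K w V : ℝ → ℝ}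
    (hP : 0 < P) (hC : 0 < C) (hKm : Measurable K)
    (hKb : ∀ y ∈ Set.Ioc 0 P, |K y| ≤ C / y)
    (hV : Monotone V)
    (hVper : ∀ x, V (x + 2 * P) = V x + β) (hwV : ∀ x y, x ≤ y → |w y - w x| ≤ V y - V x)
    (hwm : Measurable w) (hwper : Function.Periodic w (2 * P)) (hwb : ∀ x, |w x| ≤ β)
    (hδ : 0 < δ) (hδP : δ ≤ P) :
    Integrable (fun p : ℝ × ℝ => K p.2 * (w (p.1 - p.2) - w (p.1 + p.2)))
        ((volume.restrict (Set.Ioc (-P) P)).prod (volume.restrict (Set.Ioc 0 P))) ∧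
      ∫ p, ‖K p.2 * (w (p.1 - p.2) - w (p.1 + p.2))‖
        ∂((volume.restrict (Set.Ioc (-P) P)).prod (volume.restrict (Set.Ioc 0 P))) ≤
        2 * C * β * δ + 2 * C * (∫ x in Set.Ioc (-P) P, |w x|) * Real.log (P / δ) := by
  set N := ∫ x in Set.Ioc (-P) P, |w x| with hN
  set F : ℝ × ℝ → ℝ := fun p => K p.2 * (w (p.1 - p.2) - w (p.1 + p.2)) with hF
  have hFm : Measurable F := by fun_prop
  obtain ⟨hgi, hgv⟩ := integrableOn_and_integral_ite (a := 2 * C * β) (b := 2 * C * N) hδ hδP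
  have hPP : -P ≤ P := by linarith
  have hpt : ∀ y ∈ Set.Ioc 0 P, ∫ x in Set.Ioc (-P) P, ‖F (x, y)‖ ≤
      if y ≤ δ then 2 * C * β else 2 * C * N * y⁻¹ := by
    intro y hy
    have h1 := integral_abs_sub_le_variation hP hV hVper hwV hwm hy.1.le
    have h2 := integral_abs_sub_le_two_mul hP hwm hwper hwb y
    have h3 : (0 : ℝ) ≤ ∫ x in (-P)..P, |w (x - y) - w (x + y)| :=
      intervalIntegral.integral_nonneg hPP fun x _ => abs_nonneg _
    have h4 := hKb y hy
    have hy0 := hy.1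
    have hCy : 0 < C / y := by positivity
    simp only [hF, Real.norm_eq_abs, abs_mul]
    rw [integral_const_mul, ← intervalIntegral.integral_of_le hPP]
    rw [hN, ← intervalIntegral.integral_of_le hPP]
    refine (mul_le_mul_of_nonneg_right h4 h3).trans ?_
    split_ifs with h
    · refine (mul_le_mul_of_nonneg_left h1 hCy.le).trans (le_of_eq ?_)
      field_simp
    · refine (mul_le_mul_of_nonneg_left h2 hCy.le).trans (le_of_eq ?_)
      field_simp
  have hint : Integrable F
      ((volume.restrict (Set.Ioc (-P) P)).prod (volume.restrict (Set.Ioc 0 P))) := by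
    rw [integrable_prod_iff' hFm.aestronglyMeasurable]
    constructor
    · refine Eventually.of_forall fun y => ?_
      refine Integrable.mono' (g := fun _ => |K y| * (β + β)) (integrable_const _)
        (hFm.comp measurable_prodMk_right).aestronglyMeasurable (Eventually.of_forall fun x => ?_)
      simp only [hF, Real.norm_eq_abs, abs_mul]
      gcongr
      exact (abs_sub _ _).trans (add_le_add (hwb _) (hwb _))
    · refine Integrable.mono' hgi ?_ ?_
      · exact (hFm.norm.stronglyMeasurable.integral_prod_left').aestronglyMeasurable
      · filter_upwards [ae_restrict_mem measurableSet_Ioc] with y hy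
        rw [Real.norm_of_nonneg (integral_nonneg fun x => norm_nonneg _)]
        exact hpt y hy
  refine ⟨hint, ?_⟩
  rw [← hgv, integral_prod_symm _ hint.norm]
  exact setIntegral_mono_on hint.norm.integral_prod_right hgi measurableSet_Ioc hpt

lemma ae_of_periodic_of_ae_restrict {Q : ℝ → Prop} {T a : ℝ} (hT : 0 < T)
    (hQ : Function.Periodic Q T) (h : ∀ᵐ x ∂volume.restrict (Set.Ioc a (a + T)), Q x) :
    ∀ᵐ x, Q x := by
  rw [ae_restrict_iff' measurableSet_Ioc] at h
  have h' : ∀ᵐ x, ∀ n : ℤ, x + n • T ∈ Set.Ioc a (a + T) → Q (x + n • T) := ae_all_iff.2 fun n =>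
    (measurePreserving_add_right volume (n • T)).quasiMeasurePreserving.ae h
  filter_upwards [h'] with x hx
  obtain ⟨n, hn, -⟩ := existsUnique_add_zsmul_mem_Ioc hT x a
  rw [← hQ.zsmul n x]
  exact hx n hn

lemma pvPerAt_of_integrableOn {P C β x : ℝ} {K w : ℝ → ℝ} (hP : 0 < P) (hC : 0 < C)
    (hKm : Measurable K) (hKodd : ∀ x, K (-x) = -K x)
    (hKb : ∀ y ∈ Set.Ioc 0 P, |K y| ≤ C / y)
    (hwm : Measurable w) (hwb : ∀ x, |w x| ≤ β)
    (h : IntegrableOn (fun y => K y * (w (x - y) - w (x + y))) (Set.Ioc 0 P)) :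
    PVPerAt K w P x (∫ y in Set.Ioc 0 P, K y * (w (x - y) - w (x + y))) := by
  have hcont := intervalIntegral.continuousOn_primitive_interval_left (a := 0) (b := P)
    (μ := volume) (f := fun y => K y * (w (x - y) - w (x + y)))
    (by rwa [Set.uIcc_of_le hP.le, integrableOn_Icc_iff_integrableOn_Ioc])
  have hlim : Tendsto (fun ε => ∫ y in ε..P, K y * (w (x - y) - w (x + y))) (𝓝[>] 0)
      (𝓝 (∫ y in (0 : ℝ)..P, K y * (w (x - y) - w (x + y)))) := by
    have := hcont 0 Set.left_mem_uIcc
    rw [Set.uIcc_of_le hP.le] at this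
    have h2 := this.tendsto.mono_left (nhdsWithin_mono 0 Set.Ioc_subset_Icc_self)
    rwa [nhdsWithin_Ioc_eq_nhdsGT hP] at h2
  rw [intervalIntegral.integral_of_le hP.le] at hlim
  refine hlim.congr' ?_
  filter_upwards [Ioo_mem_nhdsGT hP] with ε hε
  obtain ⟨hε, hεP⟩ := hε
  have hβ : 0 ≤ β := (abs_nonneg _).trans (hwb 0)
  have hi : ∀ f : ℝ → ℝ, Measurable f →
      IntervalIntegrable (fun y => K y * w (f y)) volume ε P := by
    intro f hf
    refine (intervalIntegrable_const (c := C / ε * β)).mono_fun (by fun_prop) ?_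
    filter_upwards [ae_restrict_mem measurableSet_uIoc] with y hy
    rw [Set.uIoc_of_le hεP.le] at hy
    refine le_trans ?_ (le_abs_self _)
    rw [Real.norm_eq_abs, abs_mul]
    have := hKb y ⟨hε.trans hy.1, hy.2⟩
    have h3 : C / y ≤ C / ε := div_le_div_of_nonneg_left hC.le hε hy.1.le
    exact mul_le_mul (this.trans h3) (hwb _) (abs_nonneg _) (by positivity)
  have hm := hi (fun y => x - y) (by fun_prop)
  have hp := hi (fun y => x + y) (by fun_prop)
  have hneg : IntervalIntegrable (fun y => K y * w (x - y)) volume (-P) (-ε) := by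
    rw [IntervalIntegrable.iff_comp_neg, neg_neg, neg_neg]
    refine IntervalIntegrable.symm ?_
    simp only [hKodd, sub_neg_eq_add, neg_mul]
    exact IntervalIntegrable.neg hp
  have hset : Set.Ioo (-P) P \ Set.Ioo (-ε) ε = Set.Ioc (-P) (-ε) ∪ Set.Ico ε P := by
    ext y
    simp only [Set.mem_sdiff, Set.mem_Ioo, Set.mem_union, Set.mem_Ioc, Set.mem_Ico, not_and_or,
      not_lt]
    constructor
    · rintro ⟨⟨h1, h2⟩, h3 | h3⟩
      · exact Or.inl ⟨h1, h3⟩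
      · exact Or.inr ⟨h3, h2⟩
    · rintro (⟨h1, h2⟩ | ⟨h1, h2⟩)
      · exact ⟨⟨h1, by linarith⟩, Or.inl h2⟩
      · exact ⟨⟨by linarith, h2⟩, Or.inr h1⟩
  have hdisj : Disjoint (Set.Ioc (-P) (-ε)) (Set.Ico ε P) := by
    rw [Set.disjoint_left]
    intro y h1 h2
    linarith [h1.2, h2.1]
  have hle : -P ≤ -ε := by linarith
  rw [hset, setIntegral_union hdisj measurableSet_Ico
    ((intervalIntegrable_iff_integrableOn_Ioc_of_le hle).1 hneg)
    ((intervalIntegrable_iff_integrableOn_Ico_of_le hεP.le).1 hm),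
    integral_Ico_eq_integral_Ioc, ← intervalIntegral.integral_of_le hle,
    ← intervalIntegral.integral_of_le hεP.le,
    ← intervalIntegral.integral_comp_neg (fun y => K y * w (x - y))]
  simp only [hKodd, sub_neg_eq_add, neg_mul, mul_sub]
  rw [intervalIntegral.integral_sub hm hp, intervalIntegral.integral_neg]
  ring

/-- **Logarithmic `L¹` bound for the periodic singular convolution of a BV function**
(Lemma 3.2). Let `K` be odd, `2P`-periodic with `|K(x)| ≤ C/|x|` on `[-P,P]∖{0}`, and let
`w` be `2P`-periodic with zero average on `[-P,P]` and total variation `β_w < ∞` over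
`[-P,P]`. Then the principal value `G_per[w](x)` exists for a.e. `x` and
`‖G_per[w]‖_{L¹([-P,P])} ≤ C ‖w‖_{L¹} (2 + 3 ln 2 + 2 ln P + 2 ln β_w - 2 ln ‖w‖_{L¹})`. -/
theorem periodic_BV_L1_bound
    (P C : ℝ) (hP : 0 < P) (hC : 0 < C)
    (K : ℝ → ℝ) (hKmeas : Measurable K)
    (hKper : Function.Periodic K (2 * P))
    (hKodd : ∀ x : ℝ, K (-x) = -K x)
    (hKb : ∀ x ∈ Set.Icc (-P) P, x ≠ 0 → |K x| ≤ C / |x|)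
    (w : ℝ → ℝ) (hwmeas : Measurable w)
    (hwper : Function.Periodic w (2 * P))
    (hwavg : ∫ x in Set.Icc (-P) P, w x = 0)
    (β : ℝ) (hβ : 0 ≤ β)
    (hwTV : eVariationOn w (Set.Icc (-P) P) = ENNReal.ofReal β) :
    ∃ Gw : ℝ → ℝ,
      (∀ᵐ x ∂volume, PVPerAt K w P x (Gw x)) ∧
      IntegrableOn Gw (Set.Icc (-P) P) ∧
      ∫ x in Set.Icc (-P) P, |Gw x| ≤
        C * (∫ x in Set.Icc (-P) P, |w x|) *
          (2 + 3 * Real.log 2 + 2 * Real.log P + 2 * Real.log β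
            - 2 * Real.log (∫ x in Set.Icc (-P) P, |w x|)) := by
  have hPP : -P ≤ P := by linarith
  have h2P : 0 < 2 * P := by linarith
  have hend : -P + 2 * P = P := by ring
  have hKb' : ∀ y ∈ Set.Ioc 0 P, |K y| ≤ C / y := by
    intro y hy
    have := hKb y ⟨by linarith [hy.1], hy.2⟩ hy.1.ne'
    rwa [abs_of_pos hy.1] at this
  simp only [integral_Icc_eq_integral_Ioc] at hwavg ⊢
  obtain ⟨V, hV, hVper, hwV⟩ :=
    exists_monotone_of_periodic (a := -P) h2P hwper hβ (by rwa [hend])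
  have hwb := abs_le_of_periodic_of_integral_eq_zero hP hV hVper hwV hwmeas hwper
    (by rwa [intervalIntegral.integral_of_le hPP])
  have main := fun (δ : ℝ) (h₁ : 0 < δ) (h₂ : δ ≤ P) =>
    integrable_prod_symmetrized_kernel hP hC hKmeas hKb' hV hVper hwV hwmeas hwper hwb h₁ h₂
  have hint := (main P hP le_rfl).1
  have hle : ∫ x in Set.Ioc (-P) P, |∫ y in Set.Ioc 0 P, K y * (w (x - y) - w (x + y))| ≤
      ∫ p, ‖K p.2 * (w (p.1 - p.2) - w (p.1 + p.2))‖
        ∂((volume.restrict (Set.Ioc (-P) P)).prod (volume.restrict (Set.Ioc 0 P))) := by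
    rw [integral_prod _ hint.norm]
    exact integral_mono hint.integral_prod_left.norm hint.norm.integral_prod_left
      fun x => norm_integral_le_integral_norm fun y => K y * (w (x - y) - w (x + y))
  refine ⟨fun x => ∫ y in Set.Ioc 0 P, K y * (w (x - y) - w (x + y)), ?_, ?_, ?_⟩
  · have hae : ∀ᵐ x, IntegrableOn (fun y => K y * (w (x - y) - w (x + y))) (Set.Ioc 0 P) := by
      refine ae_of_periodic_of_ae_restrict (a := -P) h2P (fun x => ?_) ?_
      · have e1 : ∀ y, w (x + 2 * P - y) = w (x - y) := fun y => by
          rw [add_sub_right_comm, hwper]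
        have e2 : ∀ y, w (x + 2 * P + y) = w (x + y) := fun y => by
          rw [add_right_comm, hwper]
        simp only [e1, e2]
      · rw [hend]
        exact hint.prod_right_ae
    filter_upwards [hae] with x hx
    exact pvPerAt_of_integrableOn hP hC hKmeas hKodd hKb' hwmeas hwb hx
  · rw [integrableOn_Icc_iff_integrableOn_Ioc]
    exact hint.integral_prod_left
  · refine hle.trans ?_
    set A := ∫ p, ‖K p.2 * (w (p.1 - p.2) - w (p.1 + p.2))‖
        ∂((volume.restrict (Set.Ioc (-P) P)).prod (volume.restrict (Set.Ioc 0 P)))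
    have hbound := fun δ h₁ h₂ => (main δ h₁ h₂).2
    have hN0 : 0 ≤ ∫ x in Set.Ioc (-P) P, |w x| := integral_nonneg fun x => abs_nonneg _
    have hNle : ∫ x in Set.Ioc (-P) P, |w x| ≤ 2 * P * β := by
      have := intervalIntegral.norm_integral_le_of_norm_le_const (a := -P) (b := P) (C := β)
        (f := fun x => |w x|) (fun x _ => by simpa using hwb x)
      rw [intervalIntegral.integral_of_le hPP, Real.norm_of_nonneg hN0,
        show P - -P = 2 * P by ring, abs_of_pos h2P] at this
      linarith
    set N := ∫ x in Set.Ioc (-P) P, |w x|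
    rcases hN0.eq_or_lt with hN | hN
    · simp only [← hN, mul_zero, zero_mul, add_zero] at hbound ⊢
      have ht : Tendsto (fun δ => 2 * C * β * δ) (𝓝[>] (0 : ℝ)) (𝓝 0) := by
        have : Tendsto (fun δ => 2 * C * β * δ) (𝓝 (0 : ℝ)) (𝓝 (2 * C * β * 0)) :=
          (continuous_const.mul continuous_id).tendsto 0
        rw [mul_zero] at this
        exact this.mono_left nhdsWithin_le_nhds
      refine ge_of_tendsto ht ?_
      filter_upwards [Ioc_mem_nhdsGT hP] with δ hδ
      exact hbound δ hδ.1 hδ.2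
    · have hβ' : 0 < β := by
        by_contra h
        have : β = 0 := le_antisymm (not_lt.1 h) hβ
        rw [this, mul_zero] at hNle
        linarith
      have hδP : N / (2 * β) ≤ P := by
        rw [div_le_iff₀ (by positivity)]; linarith
      have := hbound (N / (2 * β)) (by positivity) hδP
      have e1 : 2 * C * β * (N / (2 * β)) = C * N := by field_simp
      have e2 : Real.log (P / (N / (2 * β))) =
          Real.log P + Real.log 2 + Real.log β - Real.log N := by
        rw [Real.log_div hP.ne' (by positivity), Real.log_div hN.ne' (by positivity),
          Real.log_mul (by norm_num) hβ'.ne']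
        ring
      rw [e1, e2] at this
      have hlog : 0 < Real.log 2 := Real.log_pos (by norm_num)
      have hCN : 0 < C * N := by positivity
      nlinarith [mul_pos hCN hlog]

end
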